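/- For every w ∈ S_n: Σ_{u: w⋖u} (1 + 2b_{w⋖u})·𝔖_u(1,...,1) = (C(n,2) − ℓ(w))·𝔖_w(1,...,1), where the sum is over strong Bruhat covers, and for a cover w ⋖ w·t_{ij} (i<j), b_{w⋖u} = #{k : i<k<j, w(k) > w(j)}. -/

import Mathlib

open Equiv Finset
open scoped Classical

/-- Number of inversions (Coxeter length) of a permutation of `Fin n`. -/
def invCount {n : ℕ} (v : Equiv.Perm (Fin n)) : ℕ :=
  (Finset.univ.filter (fun p : Fin n × Fin n => p.1 < p.2 ∧ v p.2 < v p.1)).card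

/-- `a` statistic of a (candidate) cover `v ⋖ v·t_{ij}`. -/
def aQ {n : ℕ} (v : Equiv.Perm (Fin n)) (i j : Fin n) : ℕ :=
  (Finset.univ.filter (fun k : Fin n => k < i ∧ v i < v k ∧ v k < v j)).card

/-- `b` statistic. -/
def bQ {n : ℕ} (v : Equiv.Perm (Fin n)) (i j : Fin n) : ℕ :=
  (Finset.univ.filter (fun k : Fin n => i < k ∧ k < j ∧ v j < v k)).card

/-- `c` statistic. -/
def cQ {n : ℕ} (v : Equiv.Perm (Fin n)) (i j : Fin n) : ℕ :=
  (Finset.univ.filter (fun k : Fin n => j < k ∧ v i < v k ∧ v k < v j)).card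

/-- `d` statistic. -/
def dQ {n : ℕ} (v : Equiv.Perm (Fin n)) (i j : Fin n) : ℕ :=
  (Finset.univ.filter (fun k : Fin n => i < k ∧ k < j ∧ v k < v i)).card

/-- Covering relation in strong Bruhat order. -/
def BruhatCov {n : ℕ} (v w : Equiv.Perm (Fin n)) : Prop :=
  ∃ i j : Fin n, i < j ∧ w = v * Equiv.swap i j ∧ invCount w = invCount v + 1

/-- The adjacent transposition `s_{a+1} = (a+1, a+2)` of `Fin (n+1)` (0-indexed positions `a, a+1`),
for `a : Fin n`. -/
def adjTransp {n : ℕ} (a : Fin n) : Equiv.Perm (Fin (n + 1)) :=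
  Equiv.swap a.castSucc a.succ

/-- Principal specialization `𝔖_u(1,...,1)` of the Schubert polynomial, defined via
Macdonald's reduced word identity:
`𝔖_u(1,…,1) = (1/ℓ(u)!) ∑_{reduced words (a_1,…,a_ℓ) of u} a_1 ⋯ a_ℓ`. -/
noncomputable def prinSpec {n : ℕ} (u : Equiv.Perm (Fin (n + 1))) : ℚ :=
  (∑ a ∈ Finset.univ.filter
      (fun a : Fin (invCount u) → Fin n =>
        (List.ofFn (fun i => adjTransp (a i))).prod = u),
    ∏ i, ((a i : ℕ) + 1 : ℚ)) / (invCount u).factorial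

section InversionCount

variable {n : ℕ}

theorem invCount_inv (v : Equiv.Perm (Fin n)) : invCount v⁻¹ = invCount v := by
  unfold invCount
  refine Finset.card_bij' (fun p _ => (v⁻¹ p.2, v⁻¹ p.1)) (fun p _ => (v p.2, v p.1)) ?_ ?_ ?_ ?_
  all_goals simp +contextual

theorem adjTransp_mul_self (a : Fin n) : adjTransp a * adjTransp a = 1 :=
  Equiv.swap_mul_self _ _

theorem adjTransp_inv (a : Fin n) : (adjTransp a)⁻¹ = adjTransp a :=
  Equiv.swap_inv _ _

theorem adjTransp_adjTransp (a : Fin n) (k : Fin (n + 1)) :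
    adjTransp a (adjTransp a k) = k := by
  simp [adjTransp]

theorem adjTransp_castSucc (a : Fin n) : adjTransp a a.castSucc = a.succ :=
  Equiv.swap_apply_left _ _

theorem adjTransp_succ (a : Fin n) : adjTransp a a.succ = a.castSucc :=
  Equiv.swap_apply_right _ _

theorem adjTransp_lt_of_lt (a : Fin n) {p q : Fin (n + 1)} (hpq : p < q)
    (h : ¬(p = a.castSucc ∧ q = a.succ)) : adjTransp a p < adjTransp a q := by
  rw [Fin.lt_def] at hpq ⊢
  simp only [Fin.ext_iff, Fin.val_castSucc, Fin.val_succ] at h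
  simp only [adjTransp, Equiv.swap_apply_def, Fin.ext_iff, Fin.val_castSucc, Fin.val_succ]
  split_ifs <;> (try simp only [Fin.val_castSucc, Fin.val_succ]) <;> omega

theorem adjTransp_lt_iff (a : Fin n) {p q : Fin (n + 1)}
    (h : ¬(p = a.castSucc ∧ q = a.succ)) (h' : ¬(p = a.succ ∧ q = a.castSucc)) :
    adjTransp a p < adjTransp a q ↔ p < q := by
  refine ⟨fun hlt => ?_, fun hlt => adjTransp_lt_of_lt a hlt h⟩
  have := adjTransp_lt_of_lt a hlt (by
    rintro ⟨h1, h2⟩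
    apply h'
    rw [← adjTransp_adjTransp a p, ← adjTransp_adjTransp a q, h1, h2, adjTransp_castSucc,
      adjTransp_succ]
    exact ⟨rfl, rfl⟩)
  simpa only [adjTransp_adjTransp] using this

theorem invCount_mul_adjTransp_of_lt {v : Equiv.Perm (Fin (n + 1))} {a : Fin n}
    (h : v a.castSucc < v a.succ) : invCount (v * adjTransp a) = invCount v + 1 := by
  unfold invCount
  have key : (Finset.univ.filter (fun p : Fin (n + 1) × Fin (n + 1) =>
        p.1 < p.2 ∧ (v * adjTransp a) p.2 < (v * adjTransp a) p.1)) =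
      insert (a.castSucc, a.succ) ((Finset.univ.filter (fun p : Fin (n + 1) × Fin (n + 1) =>
        p.1 < p.2 ∧ v p.2 < v p.1)).map
          ((adjTransp a).prodCongr (adjTransp a)).toEmbedding) := by
    ext ⟨p, q⟩
    obtain ⟨p, rfl⟩ := (adjTransp a).surjective p
    obtain ⟨q, rfl⟩ := (adjTransp a).surjective q
    rw [Finset.mem_filter]
    simp only [Finset.mem_insert, Finset.mem_map_equiv, Finset.mem_filter, Finset.mem_univ,
      true_and, Equiv.Perm.mul_apply, adjTransp_adjTransp, Equiv.prodCongr_symm,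
      Equiv.prodCongr_apply, Prod.map, Equiv.symm_apply_apply, Prod.mk.injEq]
    by_cases h1 : p = a.castSucc ∧ q = a.succ
    · obtain ⟨rfl, rfl⟩ := h1
      simp [adjTransp_castSucc, adjTransp_succ, Fin.ext_iff, h.not_gt]
    by_cases h2 : p = a.succ ∧ q = a.castSucc
    · obtain ⟨rfl, rfl⟩ := h2
      simp [adjTransp_castSucc, adjTransp_succ, h]
    rw [adjTransp_lt_iff a h1 h2]
    have h3 : ¬ (adjTransp a p = a.castSucc ∧ adjTransp a q = a.succ) := by
      rintro ⟨h3, h4⟩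
      apply h2
      rw [← adjTransp_adjTransp a p, ← adjTransp_adjTransp a q, h3, h4, adjTransp_castSucc,
        adjTransp_succ]
      exact ⟨rfl, rfl⟩
    tauto
  rw [key, Finset.card_insert_of_notMem, Finset.card_map]
  simp only [Finset.mem_map_equiv, Finset.mem_filter, Finset.mem_univ,
      true_and, Equiv.prodCongr_symm, Equiv.prodCongr_apply, Prod.map, not_and]
  intro h1
  exfalso
  have hs : (adjTransp a).symm = adjTransp a := adjTransp_inv a
  rw [hs, adjTransp_castSucc, adjTransp_succ] at h1
  exact absurd h1 (by simp [Fin.lt_def])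

theorem invCount_mul_adjTransp_of_gt {v : Equiv.Perm (Fin (n + 1))} {a : Fin n}
    (h : v a.succ < v a.castSucc) : invCount (v * adjTransp a) + 1 = invCount v := by
  have := invCount_mul_adjTransp_of_lt (v := v * adjTransp a) (a := a)
    (by simpa [adjTransp_castSucc, adjTransp_succ] using h)
  rw [mul_assoc, adjTransp_mul_self, mul_one] at this
  exact this.symm

theorem apply_castSucc_lt_or_gt (v : Equiv.Perm (Fin (n + 1))) (a : Fin n) :
    v a.castSucc < v a.succ ∨ v a.succ < v a.castSucc :=
  lt_or_gt_of_ne (v.injective.ne (by simp [Fin.ext_iff]))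

theorem apply_succ_lt_iff (v : Equiv.Perm (Fin (n + 1))) (a : Fin n) :
    v a.succ < v a.castSucc ↔ invCount (v * adjTransp a) + 1 = invCount v := by
  refine ⟨invCount_mul_adjTransp_of_gt, fun h => ?_⟩
  rcases apply_castSucc_lt_or_gt v a with h' | h'
  · have := invCount_mul_adjTransp_of_lt h'
    omega
  · exact h'

theorem swap_mul_adjTransp (a : Fin n) (i j : Fin (n + 1)) :
    Equiv.swap i j * adjTransp a =
      adjTransp a * Equiv.swap (adjTransp a i) (adjTransp a j) := by
  rw [Equiv.mul_swap_eq_swap_mul, adjTransp_adjTransp, adjTransp_adjTransp]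

theorem invCount_lt_invCount_mul_swap (v : Equiv.Perm (Fin (n + 1))) {i j : Fin (n + 1)}
    (hij : i < j) (hv : v i < v j) : invCount v < invCount (v * Equiv.swap i j) := by
  obtain ⟨d, hd⟩ : ∃ d : ℕ, (j : ℕ) = i + 1 + d := ⟨j - (i + 1), by rw [Fin.lt_def] at hij; omega⟩
  induction d generalizing v i with
  | zero =>
    let a : Fin n := ⟨i, by omega⟩
    have hi : i = a.castSucc := Fin.ext rfl
    have hj : j = a.succ := Fin.ext (by simpa using hd)
    rw [hi, hj] at hv ⊢
    have := invCount_mul_adjTransp_of_lt hv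
    rw [adjTransp] at this
    omega
  | succ d ih =>
    let a : Fin n := ⟨i, by omega⟩
    have hi : i = a.castSucc := Fin.ext rfl
    have hlt : a.succ < j := by
      rw [Fin.lt_def, Fin.val_succ]; change (i : ℕ) + 1 < j; omega
    have hj : adjTransp a j = j := Equiv.swap_apply_of_ne_of_ne (hi ▸ hij.ne') hlt.ne'
    have hstep := ih (v * adjTransp a) (i := a.succ) hlt
      (by simpa [adjTransp_succ, hj, ← hi] using hv)
      (by rw [hd, Fin.val_succ]; change _ = (i : ℕ) + 1 + 1 + d; omega)
    have hconj : v * adjTransp a * Equiv.swap a.succ j = v * Equiv.swap i j * adjTransp a := by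
      rw [mul_assoc v (Equiv.swap i j), swap_mul_adjTransp, hj, hi, adjTransp_castSucc, mul_assoc]
    rw [hconj] at hstep
    have hu1 : (v * Equiv.swap i j) a.castSucc = v j := by simp [← hi]
    have hu2 : (v * Equiv.swap i j) a.succ = v a.succ := by
      rw [Equiv.Perm.mul_apply, Equiv.swap_apply_of_ne_of_ne _ hlt.ne]
      simp [hi, Fin.ext_iff]
    rcases apply_castSucc_lt_or_gt v a with h | h
    · have h1 := invCount_mul_adjTransp_of_lt h
      rcases apply_castSucc_lt_or_gt (v * Equiv.swap i j) a with h' | h'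
      · have := invCount_mul_adjTransp_of_lt h'
        omega
      · have := invCount_mul_adjTransp_of_gt h'
        omega
    · have h1 := invCount_mul_adjTransp_of_gt h
      have h2 := invCount_mul_adjTransp_of_gt (v := v * Equiv.swap i j) (a := a)
      rcases apply_castSucc_lt_or_gt (v * Equiv.swap i j) a with h' | h'
      · have := invCount_mul_adjTransp_of_lt h'
        rw [hu1, hu2] at h'
        rw [← hi] at h
        exact absurd (h'.trans h) hv.le.not_gt
      · have := invCount_mul_adjTransp_of_gt h'
        omega

theorem lt_iff_invCount_lt_invCount_mul_swap (v : Equiv.Perm (Fin (n + 1))) {i j : Fin (n + 1)}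
    (hij : i < j) : v i < v j ↔ invCount v < invCount (v * Equiv.swap i j) := by
  refine ⟨invCount_lt_invCount_mul_swap v hij, fun h => ?_⟩
  by_contra hv
  have hv' : v j < v i := lt_of_le_of_ne (not_lt.mp hv) (v.injective.ne hij.ne')
  have := invCount_lt_invCount_mul_swap (v * Equiv.swap i j) hij (by simpa using hv')
  rw [mul_assoc, Equiv.swap_mul_self, mul_one] at this
  omega

end InversionCount

section Words

variable {n : ℕ}

/-- The sum of `(a_1 + 1) ⋯ (a_m + 1)` over all words of length `m` in the adjacent
transpositions whose product is `u`. -/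
noncomputable def wordSum (m : ℕ) (u : Equiv.Perm (Fin (n + 1))) : ℚ :=
  ∑ a ∈ Finset.univ.filter
      (fun a : Fin m → Fin n => (List.ofFn (fun i => adjTransp (a i))).prod = u),
    ∏ i, ((a i : ℕ) + 1 : ℚ)

theorem wordSum_succ (m : ℕ) (u : Equiv.Perm (Fin (n + 1))) :
    wordSum (m + 1) u = ∑ a : Fin n, ((a : ℕ) + 1 : ℚ) * wordSum m (adjTransp a * u) := by
  simp only [wordSum, Finset.sum_filter]
  rw [← (Fin.consEquiv (fun _ : Fin (m + 1) => Fin n)).sum_comp, Fintype.sum_prod_type]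
  refine Finset.sum_congr rfl fun a _ => ?_
  rw [Finset.mul_sum]
  refine Finset.sum_congr rfl fun b _ => ?_
  have h : adjTransp a * (List.ofFn (fun i => adjTransp (b i))).prod = u ↔
      (List.ofFn (fun i => adjTransp (b i))).prod = adjTransp a * u := by
    rw [← eq_inv_mul_iff_mul_eq, adjTransp_inv]
  simp [Fin.consEquiv, List.ofFn_succ, Fin.prod_univ_succ, h]

theorem invCount_mul_adjTransp_le (v : Equiv.Perm (Fin (n + 1))) (a : Fin n) :
    invCount (v * adjTransp a) ≤ invCount v + 1 := by
  rcases apply_castSucc_lt_or_gt v a with h | h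
  · exact (invCount_mul_adjTransp_of_lt h).le
  · have := invCount_mul_adjTransp_of_gt h
    omega

theorem invCount_one : invCount (1 : Equiv.Perm (Fin n)) = 0 := by
  rw [invCount, Finset.card_eq_zero, Finset.filter_eq_empty_iff]
  exact fun p _ h => lt_asymm h.1 h.2

theorem wordSum_eq_zero {m : ℕ} {u : Equiv.Perm (Fin (n + 1))} (h : m < invCount u) :
    wordSum m u = 0 := by
  induction m generalizing u with
  | zero =>
    rw [wordSum, Finset.sum_eq_zero]
    intro a ha
    rw [Finset.mem_filter] at ha
    have hu : u = 1 := by simpa using ha.2.symm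
    rw [hu, invCount_one] at h
    exact absurd h (lt_irrefl 0)
  | succ m ih =>
    rw [wordSum_succ]
    refine Finset.sum_eq_zero fun a _ => ?_
    rw [ih, mul_zero]
    have h1 := invCount_mul_adjTransp_le (adjTransp a * u)⁻¹ a
    rw [invCount_inv, mul_inv_rev, adjTransp_inv, mul_assoc, adjTransp_mul_self, mul_one,
      invCount_inv] at h1
    omega

/-- The weighted count of reduced words of `v⁻¹`. -/
noncomputable def redSum (v : Equiv.Perm (Fin (n + 1))) : ℚ :=
  wordSum (invCount v) v⁻¹

theorem prinSpec_eq (u : Equiv.Perm (Fin (n + 1))) :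
    prinSpec u = redSum u⁻¹ / (invCount u).factorial := by
  rw [redSum, invCount_inv, inv_inv, prinSpec, wordSum]

theorem redSum_eq_sum {v : Equiv.Perm (Fin (n + 1))} (h : invCount v ≠ 0) :
    redSum v = ∑ a : Fin n, if v a.succ < v a.castSucc then
      ((a : ℕ) + 1 : ℚ) * redSum (v * adjTransp a) else 0 := by
  obtain ⟨m, hm⟩ := Nat.exists_eq_succ_of_ne_zero h
  rw [redSum, hm, wordSum_succ]
  refine Finset.sum_congr rfl fun a _ => ?_
  have hinv : adjTransp a * v⁻¹ = (v * adjTransp a)⁻¹ := by rw [mul_inv_rev, adjTransp_inv]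
  rw [hinv]
  split_ifs with hv
  · have := invCount_mul_adjTransp_of_gt hv
    rw [redSum, show invCount (v * adjTransp a) = m by omega]
  · have := invCount_mul_adjTransp_of_lt ((apply_castSucc_lt_or_gt v a).resolve_right hv)
    rw [wordSum_eq_zero, mul_zero]
    rw [invCount_inv]
    omega

end Words

section Code

variable {n : ℕ}

/-- The Lehmer code of `v` at `k`. -/
def lehmer (v : Equiv.Perm (Fin n)) (k : Fin n) : ℕ :=
  (Finset.univ.filter (fun m : Fin n => k < m ∧ v m < v k)).card

theorem sum_lehmer (v : Equiv.Perm (Fin n)) : ∑ k, lehmer v k = invCount v := by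
  simp only [lehmer, invCount, Finset.card_filter, Fintype.sum_prod_type]

theorem lehmer_last (v : Equiv.Perm (Fin (n + 1))) : lehmer v (Fin.last n) = 0 := by
  simp only [lehmer, Finset.card_eq_zero, Finset.filter_eq_empty_iff]
  exact fun m _ h => absurd h.1 (Fin.le_last m).not_gt

theorem lehmer_succ_of_lt {v : Equiv.Perm (Fin (n + 1))} {a : Fin n}
    (h : v a.castSucc < v a.succ) :
    lehmer v a.succ = lehmer v a.castSucc + cQ v a.castSucc a.succ := by
  unfold lehmer cQ
  rw [← Finset.card_union_of_disjoint]
  · congr 1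
    ext m
    simp only [Finset.mem_union, Finset.mem_filter, Finset.mem_univ, true_and]
    have hne : v m = v a.castSucc → m = a.castSucc := fun e => v.injective e
    have hne' : m = a.succ → v m = v a.succ := fun e => by rw [e]
    simp only [Fin.lt_def, Fin.ext_iff, Fin.val_castSucc, Fin.val_succ] at *
    omega
  · rw [Finset.disjoint_filter]
    exact fun m _ h1 h2 => lt_asymm h1.2 h2.2.1

theorem lehmer_castSucc_of_gt {v : Equiv.Perm (Fin (n + 1))} {a : Fin n}
    (h : v a.succ < v a.castSucc) :
    lehmer v a.castSucc = lehmer v a.succ + cQ (v * adjTransp a) a.castSucc a.succ + 1 := by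
  unfold lehmer cQ
  rw [← Finset.card_union_of_disjoint, ← Finset.card_insert_of_notMem (a := a.succ)]
  · congr 1
    ext m
    have hm : a.succ < m → adjTransp a m = m := fun hm =>
      Equiv.swap_apply_of_ne_of_ne (ne_of_gt (lt_trans (Fin.castSucc_lt_succ) hm)) hm.ne'
    simp only [Finset.mem_insert, Finset.mem_union, Finset.mem_filter, Finset.mem_univ, true_and,
      Equiv.Perm.mul_apply, adjTransp_castSucc, adjTransp_succ]
    have hne : v m = v a.succ → m = a.succ := fun e => v.injective e
    have hne' : m = a.succ → v m = v a.succ := fun e => by rw [e]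
    by_cases hlt : a.succ < m
    · rw [hm hlt]
      simp only [Fin.lt_def, Fin.ext_iff, Fin.val_castSucc, Fin.val_succ] at *
      omega
    · simp only [Fin.lt_def, Fin.ext_iff, Fin.val_castSucc, Fin.val_succ] at *
      omega
  · rw [Finset.mem_union, Finset.mem_filter, Finset.mem_filter]
    simp
  · rw [Finset.disjoint_filter]
    intro m _ h1 h2
    have hm : adjTransp a m = m :=
      Equiv.swap_apply_of_ne_of_ne (ne_of_gt (lt_trans (Fin.castSucc_lt_succ) h1.1)) h1.1.ne'
    have h3 := h2.2.1
    simp only [Equiv.Perm.mul_apply, adjTransp_castSucc, hm] at h3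
    exact lt_asymm h1.2 h3

theorem sum_mul_sub_succ (f : Fin (n + 1) → ℚ) :
    ∑ a : Fin n, ((a : ℕ) + 1 : ℚ) * (f a.castSucc - f a.succ) =
      ∑ k, f k - (n + 1) * f (Fin.last n) := by
  induction n with
  | zero => simp
  | succ n ih =>
    rw [Fin.sum_univ_castSucc, Fin.sum_univ_castSucc f]
    have := ih (fun k => f k.castSucc)
    simp only [Fin.val_castSucc, Fin.succ_castSucc, Fin.val_last, Fin.succ_last] at this ⊢
    rw [this]
    push_cast
    ring

theorem sum_val_add_one (n : ℕ) : ∑ a : Fin n, ((a : ℕ) + 1 : ℚ) = ((n + 1).choose 2 : ℚ) := by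
  rw [Fin.sum_univ_eq_sum_range (fun a => (a + 1 : ℚ)), Nat.cast_choose_two]
  induction n with
  | zero => simp
  | succ n ih => rw [Finset.sum_range_succ, ih]; push_cast; ring

theorem sum_mul_one_sub_lehmer (v : Equiv.Perm (Fin (n + 1))) :
    ∑ a : Fin n, ((a : ℕ) + 1 : ℚ) *
        (1 - 2 * ((lehmer v a.castSucc : ℚ) - lehmer v a.succ)) =
      ((n + 1).choose 2 : ℚ) - 2 * invCount v := by
  have h := sum_mul_sub_succ (fun k => (lehmer v k : ℚ))
  rw [lehmer_last, ← Nat.cast_sum, sum_lehmer, Nat.cast_zero] at h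
  rw [← sum_val_add_one]
  simp only [mul_sub, Finset.sum_sub_distrib, mul_one, mul_left_comm _ (2 : ℚ),
    ← Finset.mul_sum] at h ⊢
  linarith

end Code

section Commutator

variable {n : ℕ}

/-- The weighted sum of `redSum` over the strong Bruhat covers of `v`, with weights `1 + 2c`. -/
noncomputable def coverSum (v : Equiv.Perm (Fin (n + 1))) : ℚ :=
  ∑ p : Fin (n + 1) × Fin (n + 1),
    if p.1 < p.2 ∧ invCount (v * Equiv.swap p.1 p.2) = invCount v + 1 then
      (1 + 2 * (cQ v p.1 p.2 : ℚ)) * redSum (v * Equiv.swap p.1 p.2) else 0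

theorem cQ_mul_adjTransp {v : Equiv.Perm (Fin (n + 1))} {a : Fin n} {i j : Fin (n + 1)}
    (hij : i < j) (hne : ¬(i = a.castSucc ∧ j = a.succ)) (hv : v a.succ < v a.castSucc)
    (hu : (v * Equiv.swap i j) a.succ < (v * Equiv.swap i j) a.castSucc) :
    cQ (v * adjTransp a) (adjTransp a i) (adjTransp a j) = cQ v i j := by
  unfold cQ
  refine Finset.card_equiv (adjTransp a) fun k => ?_
  rw [Finset.mem_filter, Finset.mem_filter]
  simp only [Finset.mem_univ, true_and, Equiv.Perm.mul_apply, adjTransp_adjTransp]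
  refine and_congr_left fun h => ?_
  rw [← adjTransp_lt_iff a (p := j) (q := adjTransp a k), adjTransp_adjTransp]
  · rintro ⟨rfl, hk⟩
    rw [hk] at h
    rw [Equiv.Perm.mul_apply, Equiv.Perm.mul_apply, Equiv.swap_apply_right,
      Equiv.swap_apply_of_ne_of_ne (hij.trans Fin.castSucc_lt_succ).ne'
        Fin.castSucc_lt_succ.ne'] at hu
    exact lt_asymm h.1 hu
  · rintro ⟨rfl, hk⟩
    rw [hk] at h
    exact lt_asymm h.2 hv

theorem cover_and_descent_iff (v : Equiv.Perm (Fin (n + 1))) (a : Fin n) {i j : Fin (n + 1)}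
    (hij : i < j) (hne : ¬(i = a.castSucc ∧ j = a.succ)) :
    (invCount (v * Equiv.swap i j) = invCount v + 1 ∧
        (v * Equiv.swap i j) a.succ < (v * Equiv.swap i j) a.castSucc) ↔
      (v a.succ < v a.castSucc ∧
        invCount (v * adjTransp a * Equiv.swap (adjTransp a i) (adjTransp a j)) =
          invCount (v * adjTransp a) + 1) := by
  have hij' := adjTransp_lt_of_lt a hij hne
  have h1 := lt_iff_invCount_lt_invCount_mul_swap v hij
  have h2 := lt_iff_invCount_lt_invCount_mul_swap (v * adjTransp a) hij'
  have h3 := apply_succ_lt_iff v a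
  have h4 := apply_succ_lt_iff (v * Equiv.swap i j) a
  have h5 := @invCount_mul_adjTransp_of_lt n v a
  have h6 := @invCount_mul_adjTransp_of_lt n (v * Equiv.swap i j) a
  have h7 := apply_castSucc_lt_or_gt v a
  have h8 := apply_castSucc_lt_or_gt (v * Equiv.swap i j) a
  have hconj : v * Equiv.swap i j * adjTransp a =
      v * adjTransp a * Equiv.swap (adjTransp a i) (adjTransp a j) := by
    rw [mul_assoc, swap_mul_adjTransp, mul_assoc]
  rw [hconj] at h4 h6
  rw [Equiv.Perm.mul_apply v (adjTransp a) (adjTransp a i), adjTransp_adjTransp,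
    Equiv.Perm.mul_apply v (adjTransp a) (adjTransp a j), adjTransp_adjTransp] at h2
  rw [h1] at h2
  rw [h3] at h7 ⊢
  rw [h4] at h8 ⊢
  have h7' : invCount (v * adjTransp a) = invCount v + 1 ∨
    invCount (v * adjTransp a) + 1 = invCount v := h7.imp_left h5
  have h8' := h8.imp_left h6
  omega

theorem sum_cover_descent_sub (v : Equiv.Perm (Fin (n + 1))) (a : Fin n) :
    (∑ p : Fin (n + 1) × Fin (n + 1),
      if p.1 < p.2 ∧ invCount (v * Equiv.swap p.1 p.2) = invCount v + 1 ∧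
          (v * Equiv.swap p.1 p.2) a.succ < (v * Equiv.swap p.1 p.2) a.castSucc then
        (1 + 2 * (cQ v p.1 p.2 : ℚ)) * redSum (v * Equiv.swap p.1 p.2 * adjTransp a) else 0) -
      (if v a.succ < v a.castSucc then coverSum (v * adjTransp a) else 0) =
    (1 - 2 * ((lehmer v a.castSucc : ℚ) - lehmer v a.succ)) * redSum v := by
  have hne : a.castSucc ≠ a.succ := Fin.castSucc_lt_succ.ne
  have hcov : (if v a.succ < v a.castSucc then coverSum (v * adjTransp a) else 0) =
      ∑ p : Fin (n + 1) × Fin (n + 1), if v a.succ < v a.castSucc ∧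
        adjTransp a p.1 < adjTransp a p.2 ∧
          invCount (v * adjTransp a * Equiv.swap (adjTransp a p.1) (adjTransp a p.2)) =
            invCount (v * adjTransp a) + 1 then
        (1 + 2 * (cQ (v * adjTransp a) (adjTransp a p.1) (adjTransp a p.2) : ℚ)) *
          redSum (v * adjTransp a * Equiv.swap (adjTransp a p.1) (adjTransp a p.2)) else 0 := by
    split_ifs with h
    · rw [coverSum, ← ((adjTransp a).prodCongr (adjTransp a)).sum_comp]
      simp only [h, true_and, Equiv.prodCongr_apply, Prod.map]
    · simp [h]
  rw [hcov, ← Finset.sum_sub_distrib, Fintype.sum_eq_add (a.castSucc, a.succ) (a.succ, a.castSucc)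
    (by simp [hne])]
  · have hswap : Equiv.swap a.castSucc a.succ = adjTransp a := rfl
    have hasc : ¬ a.succ < a.castSucc := Fin.castSucc_lt_succ.not_gt
    simp only [adjTransp_castSucc, adjTransp_succ, Equiv.swap_comm a.succ, hswap, hasc,
      Fin.castSucc_lt_succ, mul_assoc, adjTransp_mul_self, mul_one, Equiv.Perm.mul_apply,
      true_and, false_and, and_false, if_false, sub_zero, zero_sub]
    rcases apply_castSucc_lt_or_gt v a with h | h
    · have h1 := invCount_mul_adjTransp_of_lt h
      rw [if_pos ⟨h1, h⟩, if_neg (fun h' => lt_asymm h h'.1), lehmer_succ_of_lt h]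
      push_cast
      ring
    · have h1 := invCount_mul_adjTransp_of_gt h
      rw [if_neg (fun h' => lt_asymm h h'.2), if_pos ⟨h, h1.symm⟩, lehmer_castSucc_of_gt h]
      push_cast
      ring
  · rintro ⟨i, j⟩ ⟨h1, h2⟩
    rw [Ne, Prod.mk.injEq] at h1 h2
    have hlt := adjTransp_lt_iff a h1 h2
    simp only [hlt]
    by_cases hij : i < j
    · have hiff := cover_and_descent_iff v a hij h1
      by_cases hc : invCount (v * Equiv.swap i j) = invCount v + 1 ∧
        (v * Equiv.swap i j) a.succ < (v * Equiv.swap i j) a.castSucc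
      · have hc' := hiff.mp hc
        rw [if_pos ⟨hij, hc⟩, if_pos ⟨hc'.1, hij, hc'.2⟩, cQ_mul_adjTransp hij h1 hc'.1 hc.2,
          mul_assoc v (Equiv.swap i j), swap_mul_adjTransp, mul_assoc v (adjTransp a), sub_self]
      · rw [if_neg (fun h => hc h.2), if_neg (fun h => hc (hiff.mpr ⟨h.1, h.2.2⟩)), sub_self]
    · rw [if_neg (fun h => hij h.1), if_neg (fun h => hij h.2.1), sub_self]

theorem coverSum_eq (v : Equiv.Perm (Fin (n + 1))) :
    coverSum v = (∑ a : Fin n, if v a.succ < v a.castSucc then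
        ((a : ℕ) + 1 : ℚ) * coverSum (v * adjTransp a) else 0) +
      (((n + 1).choose 2 : ℚ) - 2 * invCount v) * redSum v := by
  have hexp : coverSum v = ∑ a : Fin n, ((a : ℕ) + 1 : ℚ) *
      ∑ p : Fin (n + 1) × Fin (n + 1),
      if p.1 < p.2 ∧ invCount (v * Equiv.swap p.1 p.2) = invCount v + 1 ∧
          (v * Equiv.swap p.1 p.2) a.succ < (v * Equiv.swap p.1 p.2) a.castSucc then
        (1 + 2 * (cQ v p.1 p.2 : ℚ)) * redSum (v * Equiv.swap p.1 p.2 * adjTransp a) else 0 := by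
    simp only [Finset.mul_sum]
    rw [Finset.sum_comm, coverSum]
    refine Finset.sum_congr rfl fun p _ => ?_
    split_ifs with h
    · rw [redSum_eq_sum (by omega), Finset.mul_sum]
      refine Finset.sum_congr rfl fun a _ => ?_
      simp only [h.1, h.2, true_and]
      split_ifs <;> ring
    · symm
      refine Finset.sum_eq_zero fun a _ => ?_
      rw [if_neg (fun h' => h ⟨h'.1, h'.2.1⟩), mul_zero]
  rw [hexp, ← sub_eq_iff_eq_add', ← Finset.sum_sub_distrib, ← sum_mul_one_sub_lehmer,
    Finset.sum_mul]
  refine Finset.sum_congr rfl fun a _ => ?_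
  rw [mul_assoc, ← sum_cover_descent_sub]
  split_ifs <;> ring

theorem coverSum_eq_mul_redSum (v : Equiv.Perm (Fin (n + 1))) :
    coverSum v =
      (invCount v + 1) * (((n + 1).choose 2 : ℚ) - invCount v) * redSum v := by
  induction hm : invCount v generalizing v with
  | zero =>
    rw [coverSum_eq, hm, Finset.sum_eq_zero]
    · push_cast
      ring
    · intro a _
      refine if_neg fun h => ?_
      rw [apply_succ_lt_iff] at h
      omega
  | succ m ih =>
    have hsum : (∑ a : Fin n, if v a.succ < v a.castSucc then
        ((a : ℕ) + 1 : ℚ) * coverSum (v * adjTransp a) else 0) =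
        (m + 1) * (((n + 1).choose 2 : ℚ) - m) * redSum v := by
      rw [redSum_eq_sum (by omega), Finset.mul_sum]
      refine Finset.sum_congr rfl fun a _ => ?_
      split_ifs with h
      · have := invCount_mul_adjTransp_of_gt h
        rw [ih _ (by omega)]
        ring
      · ring
    rw [coverSum_eq, hsum, hm]
    push_cast
    ring

theorem cQ_inv (w : Equiv.Perm (Fin n)) (i j : Fin n) : cQ w⁻¹ (w i) (w j) = bQ w i j := by
  unfold cQ bQ
  refine Finset.card_equiv w⁻¹ fun k => ?_
  rw [Finset.mem_filter, Finset.mem_filter]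
  simp [and_comm, and_left_comm]

theorem inv_mul_swap_apply (w : Equiv.Perm (Fin n)) (i j : Fin n) :
    w⁻¹ * Equiv.swap (w i) (w j) = (w * Equiv.swap i j)⁻¹ := by
  rw [mul_inv_rev, Equiv.swap_inv, Equiv.swap_mul_eq_mul_swap, inv_inv]

theorem sum_bQ_redSum_inv (w : Equiv.Perm (Fin (n + 1))) :
    ∑ p ∈ Finset.univ.filter
        (fun p : Fin (n + 1) × Fin (n + 1) =>
          p.1 < p.2 ∧ invCount (w * Equiv.swap p.1 p.2) = invCount w + 1),
      (1 + 2 * (bQ w p.1 p.2 : ℚ)) * redSum (w * Equiv.swap p.1 p.2)⁻¹ = coverSum w⁻¹ := by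
  rw [coverSum, ← (w.prodCongr w).sum_comp, Finset.sum_filter]
  refine Finset.sum_congr rfl fun ⟨i, j⟩ _ => ?_
  simp only [Equiv.prodCongr_apply, Prod.map, inv_mul_swap_apply, invCount_inv, cQ_inv]
  have hiff : (i < j ∧ invCount (w * Equiv.swap i j) = invCount w + 1) ↔
      (w i < w j ∧ invCount (w * Equiv.swap i j) = invCount w + 1) := by
    refine and_congr_left fun h => ⟨fun hij => ?_, fun hij => ?_⟩
    · rw [lt_iff_invCount_lt_invCount_mul_swap w hij]
      omega
    · have := lt_iff_invCount_lt_invCount_mul_swap w⁻¹ hij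
      rw [inv_mul_swap_apply, invCount_inv, invCount_inv] at this
      simpa using this.mpr (by omega)
  simp only [hiff]

end Commutator

theorem sum_code_weight_prinSpec {n : ℕ} (w : Equiv.Perm (Fin (n + 1))) :
    ∑ p ∈ Finset.univ.filter
        (fun p : Fin (n + 1) × Fin (n + 1) =>
          p.1 < p.2 ∧ invCount (w * Equiv.swap p.1 p.2) = invCount w + 1),
      (1 + 2 * (bQ w p.1 p.2 : ℚ)) * prinSpec (w * Equiv.swap p.1 p.2) =
      (((n + 1).choose 2 : ℚ) - (invCount w : ℚ)) * prinSpec w := by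
  have hsum : ∑ p ∈ Finset.univ.filter
        (fun p : Fin (n + 1) × Fin (n + 1) =>
          p.1 < p.2 ∧ invCount (w * Equiv.swap p.1 p.2) = invCount w + 1),
      (1 + 2 * (bQ w p.1 p.2 : ℚ)) * prinSpec (w * Equiv.swap p.1 p.2) =
      coverSum w⁻¹ / (invCount w + 1).factorial := by
    rw [← sum_bQ_redSum_inv, Finset.sum_div]
    refine Finset.sum_congr rfl fun p hp => ?_
    rw [prinSpec_eq, (Finset.mem_filter.mp hp).2.2]
    ring
  rw [hsum, coverSum_eq_mul_redSum, prinSpec_eq, invCount_inv, Nat.factorial_succ]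
  have h1 : ((invCount w).factorial : ℚ) ≠ 0 := by exact_mod_cast Nat.factorial_ne_zero _
  have h2 : ((invCount w : ℚ) + 1) ≠ 0 := by positivity
  push_cast
  field_simp
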